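/- arXiv:1007.4290 — 2 statements merged into one kernel-verified Lean document; each statement's English description precedes it below -/
import Mathlib

section
/- Inversion of the sweeping factorization: under the stated hypotheses, the matrix A is invertible and A^{−1} = (L_1ᵀ)^{−1} · (L_2ᵀ)^{−1} ⋯ (L_{n−1}ᵀ)^{−1} · diag(S_1^{−1}, …, S_n^{−1}) · (L_{n−1})^{−1} ⋯ (L_2)^{−1} · (L_1)^{−1}, where diag(S_1^{−1}, …, S_n^{−1}) denotes the nk×nk block diagonal matrix with diagonal blocks S_1^{−1}, …, S_n^{−1}. -/
open Matrix

def swBlk (n k : ℕ) (F : ℕ → ℕ → Matrix (Fin k) (Fin k) ℂ) :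
    Matrix (Fin n × Fin k) (Fin n × Fin k) ℂ :=
  Matrix.of fun p q => F p.1.val q.1.val p.2 q.2

def swL {k : ℕ} (r : ℕ) (B : Matrix (Fin k) (Fin k) ℂ) : ℕ → ℕ → Matrix (Fin k) (Fin k) ℂ :=
  fun i j => if i = j then 1 else if i = r + 1 ∧ j = r then B else 0

def swT {k : ℕ} (A : ℕ → ℕ → Matrix (Fin k) (Fin k) ℂ) (S : ℕ → Matrix (Fin k) (Fin k) ℂ)
    (r : ℕ) : ℕ → ℕ → Matrix (Fin k) (Fin k) ℂ :=
  fun i j => if i = j then (if i ≤ r then S i else A i j) else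
    if r ≤ i ∧ r ≤ j then A i j else 0

theorem swBlk_congr {n k : ℕ} {F G : ℕ → ℕ → Matrix (Fin k) (Fin k) ℂ}
    (h : ∀ i j, i < n → j < n → F i j = G i j) : swBlk n k F = swBlk n k G := by
  ext p q
  simp only [swBlk, Matrix.of_apply]
  rw [h _ _ p.1.2 q.1.2]

theorem swBlk_mul {n k : ℕ} (F G : ℕ → ℕ → Matrix (Fin k) (Fin k) ℂ) :
    swBlk n k F * swBlk n k G = swBlk n k (fun i j => ∑ l : Fin n, F i l * G l j) := by
  ext p q
  simp only [swBlk, Matrix.of_apply, Matrix.mul_apply, Matrix.sum_apply, Fintype.sum_prod_type]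

theorem swBlk_transpose {n k : ℕ} (F : ℕ → ℕ → Matrix (Fin k) (Fin k) ℂ) :
    (swBlk n k F)ᵀ = swBlk n k (fun i j => (F j i)ᵀ) := by
  ext p q
  simp [swBlk]

theorem swBlk_one {n k : ℕ} :
    swBlk n k (fun i j => if i = j then 1 else 0) = 1 := by
  ext ⟨i, a⟩ ⟨j, b⟩
  simp only [swBlk, Matrix.of_apply, Matrix.one_apply, Prod.mk.injEq, Fin.ext_iff]
  by_cases h : i.val = j.val <;> simp [h, Matrix.one_apply, Fin.ext_iff]

theorem swL_mul {n k r : ℕ} (hr : r < n) (B : Matrix (Fin k) (Fin k) ℂ)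
    (G : ℕ → ℕ → Matrix (Fin k) (Fin k) ℂ) :
    swBlk n k (swL r B) * swBlk n k G =
      swBlk n k (fun i j => G i j + if i = r + 1 then B * G r j else 0) := by
  rw [swBlk_mul]
  apply swBlk_congr
  intro i j hi hj
  have h : ∀ l : Fin n, swL r B i l * G l j =
      (if l = ⟨i, hi⟩ then G i j else 0) +
        (if l = ⟨r, hr⟩ then (if i = r + 1 then B * G r j else 0) else 0) := by
    intro l
    simp only [swL, Fin.ext_iff]
    by_cases h1 : i = l.val
    · subst h1
      by_cases h2 : l.val = r
      · simp [h2]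
      · simp [h2]
    · have h1' : ¬ l.val = i := fun h => h1 h.symm
      by_cases h2 : l.val = r
      · by_cases h3 : i = r + 1
        · simp [h2, h3]
        · have : ¬ i = r := fun h => h1 (by omega)
          have h5 : ¬ r = i := fun h => h1 (by omega)
          simp [h2, h3, this, h5]
      · simp [h1, h1', h2]
  rw [Finset.sum_congr rfl (fun l _ => h l), Finset.sum_add_distrib]
  simp

theorem swL_unit {n k r : ℕ} (hr : r < n) (B : Matrix (Fin k) (Fin k) ℂ) :
    IsUnit (swBlk n k (swL r B)) := by
  have h : swBlk n k (swL r B) * swBlk n k (swL r (-B)) = 1 := by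
    rw [swL_mul hr, ← swBlk_one]
    apply swBlk_congr
    intro i j hi hj
    simp only [swL]
    by_cases h1 : i = j
    · subst h1
      by_cases h2 : i = r + 1
      · simp [h2]
      · simp [h2]
    · by_cases h2 : i = r + 1
      · subst h2
        by_cases h3 : j = r
        · simp [h3]
        · have : ¬ r = j := fun h => h3 h.symm
          simp [h1, h3, this]
      · simp [h1, h2]
  exact IsUnit.of_mul_eq_one _ h

theorem mul_swL_transpose {n k r : ℕ} (hr : r < n) (B : Matrix (Fin k) (Fin k) ℂ)
    (G : ℕ → ℕ → Matrix (Fin k) (Fin k) ℂ) :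
    swBlk n k G * (swBlk n k (swL r B))ᵀ =
      swBlk n k (fun i j => G i j + if j = r + 1 then G i r * Bᵀ else 0) := by
  rw [← Matrix.transpose_transpose (swBlk n k G), ← Matrix.transpose_mul, swBlk_transpose,
    swL_mul hr, swBlk_transpose]
  apply swBlk_congr
  intro i j hi hj
  by_cases h : j = r + 1 <;> simp [h]

theorem swT_step {n k r : ℕ} (hr : r + 1 < n)
    (A : ℕ → ℕ → Matrix (Fin k) (Fin k) ℂ)
    (htri : ∀ i j : ℕ, i < n → j < n → 1 < |(i : ℤ) - (j : ℤ)| → A i j = 0)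
    (hsym : ∀ i j : ℕ, i < n → j < n → A j i = (A i j)ᵀ)
    (S : ℕ → Matrix (Fin k) (Fin k) ℂ)
    (hSrec : S (r + 1) = A (r + 1) (r + 1) - A (r + 1) r * (S r)⁻¹ * A r (r + 1))
    (hSinv : IsUnit (S r)) (hSsym : (S r)ᵀ = S r) :
    swBlk n k (swT A S r) = swBlk n k (swL r (A (r + 1) r * (S r)⁻¹)) *
      swBlk n k (swT A S (r + 1)) * (swBlk n k (swL r (A (r + 1) r * (S r)⁻¹)))ᵀ := by
  have hd : IsUnit (S r).det := (Matrix.isUnit_iff_isUnit_det _).1 hSinv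
  rw [swL_mul (by omega), mul_swL_transpose (by omega)]
  have hBt : (A (r + 1) r * (S r)⁻¹)ᵀ = (S r)⁻¹ * A r (r + 1) := by
    rw [Matrix.transpose_mul, Matrix.transpose_nonsing_inv, hSsym, ← hsym _ _ hr (by omega)]
  have hBS : A (r + 1) r * (S r)⁻¹ * S r = A (r + 1) r :=
    Matrix.nonsing_inv_mul_cancel_right _ _ hd
  have hSB : S r * ((S r)⁻¹ * A r (r + 1)) = A r (r + 1) :=
    Matrix.mul_nonsing_inv_cancel_left _ _ hd
  rw [hBt]
  have hrow : ∀ j, swT A S (r + 1) r j = if j = r then S r else 0 := by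
    intro j
    by_cases h : j = r
    · simp [swT, h]
    · have : ¬ r = j := fun h' => h h'.symm
      simp [swT, h, this]
  have hcol : ∀ j, swT A S (r + 1) j r = if j = r then S r else 0 := by
    intro j
    by_cases h : j = r
    · simp [swT, h]
    · simp [swT, h]
  apply swBlk_congr
  intro i j hi hj
  simp only [hrow, hcol]
  have hz : ∀ i j, i < n → j < n → (i + 1 < j ∨ j + 1 < i) → A i j = 0 := by
    intro i j hi hj h
    apply htri i j hi hj
    rw [lt_abs]
    omega
  by_cases hi1 : i = r + 1
  · subst hi1
    by_cases hj1 : j = r + 1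
    · subst hj1
      simp [swT, hBS, hSrec, mul_assoc]
    · by_cases hj2 : j = r
      · subst hj2
        simp [swT, hBS]
      · have e1 : ¬ r + 1 = j := fun h => hj1 h.symm
        by_cases hj3 : r + 1 ≤ j
        · have : r ≤ j := by omega
          simp [swT, hj1, hj2, e1, hj3, this]
        · have : ¬ r ≤ j := by omega
          simp [swT, hj1, hj2, e1, hj3, this]
  · by_cases hi2 : i = r
    · subst hi2
      by_cases hj1 : j = i + 1
      · subst hj1
        simp [swT, hSB]
      · by_cases hj2 : j = i
        · subst hj2
          simp [swT]
        · have e1 : ¬ i = j := fun h => hj2 h.symm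
          by_cases hj3 : i ≤ j
          · have := hz i j hi hj (by omega)
            simp [swT, hj1, e1, this]
          · simp [swT, hj1, e1, hj3]
    · by_cases hij : i = j
      · subst hij
        by_cases h : i ≤ r
        · have : i ≤ r + 1 := by omega
          simp [swT, hi1, h, this]
        · have : ¬ i ≤ r + 1 := by omega
          simp [swT, hi1, h, this]
      · by_cases hj2 : j = r
        · subst hj2
          by_cases h : j ≤ i
          · have := hz i j hi hj (by omega)
            simp [swT, hi1, hi2, this]
          · simp [swT, hi1, hi2, h]
        · have e : (r < i ∧ r < j) ↔ (r ≤ i ∧ r ≤ j) := by omega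
          simp [swT, hi1, hi2, hij, e]

/-- **Inversion of the sweeping factorization.**  Under the hypotheses of the
sweeping factorization, `A` is invertible and
`A⁻¹ = (L_1ᵀ)⁻¹ ⋯ (L_{n-1}ᵀ)⁻¹ · diag(S_1⁻¹, …, S_n⁻¹) · (L_{n-1})⁻¹ ⋯ (L_1)⁻¹`. -/
theorem sweeping_factorization_inverse
    (n k : ℕ) (hn : 1 ≤ n) (hk : 1 ≤ k)
    (A : ℕ → ℕ → Matrix (Fin k) (Fin k) ℂ)
    (htri : ∀ i j : ℕ, i < n → j < n → 1 < |(i : ℤ) - (j : ℤ)| → A i j = 0)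
    (hsym : ∀ i j : ℕ, i < n → j < n → A j i = (A i j)ᵀ)
    (S : ℕ → Matrix (Fin k) (Fin k) ℂ)
    (hS0 : S 0 = A 0 0)
    (hSrec : ∀ m : ℕ, 0 < m → m < n →
      S m = A m m - A m (m - 1) * (S (m - 1))⁻¹ * A (m - 1) m)
    (hSinv : ∀ m : ℕ, m < n → IsUnit (S m))
    (bigA : Matrix (Fin n × Fin k) (Fin n × Fin k) ℂ)
    (hbigA : bigA = Matrix.of fun p q => A p.1.val q.1.val p.2 q.2)
    (L : ℕ → Matrix (Fin n × Fin k) (Fin n × Fin k) ℂ)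
    (hL : ∀ m : ℕ, m < n - 1 → L m = Matrix.of fun p q =>
      if p.1 = q.1 then (1 : Matrix (Fin k) (Fin k) ℂ) p.2 q.2
      else if p.1.val = m + 1 ∧ q.1.val = m then (A (m + 1) m * (S m)⁻¹) p.2 q.2
      else 0)
    (bigDinv : Matrix (Fin n × Fin k) (Fin n × Fin k) ℂ)
    (hbigDinv : bigDinv = Matrix.of fun p q =>
      if p.1 = q.1 then (S p.1.val)⁻¹ p.2 q.2 else 0) :
    IsUnit bigA ∧
      bigA⁻¹ = ((List.range (n - 1)).map (fun m => ((L m)ᵀ)⁻¹)).prod * bigDinv *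
        ((List.range (n - 1)).reverse.map (fun m => (L m)⁻¹)).prod := by
  have hSsym : ∀ m, m < n → (S m)ᵀ = S m := by
    intro m
    induction m with
    | zero => intro h; rw [hS0]; exact (hsym 0 0 h h).symm
    | succ m ih =>
      intro h
      have hm : m < n := by omega
      rw [hSrec (m + 1) (by omega) h, Nat.add_sub_cancel]
      rw [Matrix.transpose_sub, Matrix.transpose_mul, Matrix.transpose_mul,
        Matrix.transpose_nonsing_inv, ih hm, ← hsym _ _ h h, ← hsym _ _ h hm, ← hsym _ _ hm h,
        mul_assoc]
  have hL' : ∀ m, m < n - 1 → L m = swBlk n k (swL m (A (m + 1) m * (S m)⁻¹)) := by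
    intro m hm
    rw [hL m hm]
    ext p q
    simp only [swBlk, swL, Matrix.of_apply, Fin.ext_iff]
    split_ifs <;> rfl
  have hA0 : bigA = swBlk n k (swT A S 0) := by
    rw [hbigA]
    change swBlk n k A = _
    apply swBlk_congr
    intro i j hi hj
    by_cases h : i = j
    · subst h
      by_cases h0 : i = 0
      · subst h0; simp [swT, hS0]
      · simp [swT, h0]
    · simp [swT, h]
  have hstep : ∀ m, m < n - 1 →
      swBlk n k (swT A S m) = L m * swBlk n k (swT A S (m + 1)) * (L m)ᵀ := by
    intro m hm
    rw [hL' m hm]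
    have h1 := hSrec (m + 1) (by omega) (by omega)
    rw [Nat.add_sub_cancel] at h1
    exact swT_step (by omega) A htri hsym S h1 (hSinv m (by omega)) (hSsym m (by omega))
  have hLu : ∀ m, m < n - 1 → IsUnit (L m) := by
    intro m hm
    rw [hL' m hm]
    exact swL_unit (by omega) _
  have hDm : swBlk n k (swT A S (n - 1)) * bigDinv = 1 := by
    have h1 : bigDinv = swBlk n k (fun i j => if i = j then (S i)⁻¹ else 0) := by
      rw [hbigDinv]
      ext p q
      simp only [swBlk, Matrix.of_apply, Fin.ext_iff]
      split_ifs <;> rfl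
    rw [h1, swBlk_mul, ← swBlk_one]
    apply swBlk_congr
    intro i j hi hj
    rw [Finset.sum_eq_single (⟨j, hj⟩ : Fin n)]
    · by_cases h : i = j
      · subst h
        have h2 : i ≤ n - 1 := by omega
        simp [swT, h2, Matrix.mul_nonsing_inv _
          ((Matrix.isUnit_iff_isUnit_det _).1 (hSinv i hi))]
      · have h2 : ¬ (n - 1 ≤ i ∧ n - 1 ≤ j) := by omega
        simp only [swT, if_neg h, if_neg h2, zero_mul]
    · intro l _ hl
      have : ¬ l.val = j := fun h => hl (Fin.ext h)
      simp [this]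
    · simp
  have key : ∀ r, r ≤ n - 1 → (IsUnit (swBlk n k (swT A S r)) → IsUnit bigA) ∧
      bigA⁻¹ = ((List.range r).map (fun m => ((L m)ᵀ)⁻¹)).prod * (swBlk n k (swT A S r))⁻¹ *
        ((List.range r).reverse.map (fun m => (L m)⁻¹)).prod := by
    intro r
    induction r with
    | zero => intro _; simp [hA0]
    | succ r ih =>
      intro hr
      obtain ⟨h1, h2⟩ := ih (by omega)
      refine ⟨fun h => h1 ?_, ?_⟩
      · rw [hstep r (by omega)]
        have hu := hLu r (by omega)
        exact (hu.mul h).mul ((Matrix.isUnit_transpose _).2 hu)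
      · rw [h2, hstep r (by omega)]
        simp [List.range_succ, Matrix.mul_inv_rev, mul_assoc]
  obtain ⟨h1, h2⟩ := key (n - 1) le_rfl
  refine ⟨h1 (IsUnit.of_mul_eq_one _ hDm), ?_⟩
  rw [h2, Matrix.inv_eq_right_inv hDm]
end

section
/- Correctness of the sweeping solve (Algorithm 2.2): let f_1, …, f_n ∈ ℂ^k and define vectors v_1, …, v_n ∈ ℂ^k by the forward recursion v_1 = f_1 and v_{m+1} = f_{m+1} − A_{m+1,m} (S_m^{−1} v_m) for m = 1, …, n−1, and then vectors u_1, …, u_n ∈ ℂ^k by the backward recursion u_n = S_n^{−1} v_n and u_m = S_m^{−1} v_m − S_m^{−1} (A_{m,m+1} u_{m+1}) for m = n−1, …, 1. Then the stacked block vector u = (u_1, …, u_n) ∈ ℂ^{nk} satisfies A u = f, where f = (f_1, …, f_n). -/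
open Matrix

theorem tri_sum {M : Type*} [AddCommMonoid M] (n i : ℕ) (hi : i < n) (g : ℕ → M)
    (hg : ∀ j, j < n → j + 1 ≠ i → j ≠ i → j ≠ i + 1 → g j = 0) :
    ∑ j ∈ Finset.range n, g j =
      (if 0 < i then g (i - 1) else 0) + g i + (if i + 1 < n then g (i + 1) else 0) := by
  have h1 : ∑ j ∈ Finset.range n, g j = ∑ j ∈ Finset.range n,
      (((if 0 < i then (if j = i - 1 then g j else 0) else 0) + (if j = i then g j else 0))
        + (if j = i + 1 then g j else 0)) := by
    refine Finset.sum_congr rfl fun j hj => ?_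
    have hj' := Finset.mem_range.1 hj
    by_cases a : j + 1 = i
    · have h1 : 0 < i := by omega
      have h2 : j = i - 1 := by omega
      have h3 : j ≠ i := by omega
      have h4 : j ≠ i + 1 := by omega
      rw [if_pos h1, if_pos h2, if_neg h3, if_neg h4, add_zero, add_zero]
    · have h0 : (if 0 < i then (if j = i - 1 then g j else 0) else 0) = 0 := by
        split_ifs
        · omega
        · rfl
        · rfl
      rw [h0, zero_add]
      by_cases b : j = i
      · have h4 : j ≠ i + 1 := by omega
        rw [if_pos b, if_neg h4, add_zero]
      · by_cases c : j = i + 1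
        · rw [if_neg b, if_pos c, zero_add]
        · rw [if_neg b, if_neg c, zero_add, hg j hj' a b c]
  rw [h1, Finset.sum_add_distrib, Finset.sum_add_distrib]
  congr 1
  · congr 1
    · split_ifs with h
      · rw [Finset.sum_ite_eq', if_pos (Finset.mem_range.2 (by omega))]
      · simp
    · rw [Finset.sum_ite_eq', if_pos (Finset.mem_range.2 hi)]
  · rw [Finset.sum_ite_eq']
    simp only [Finset.mem_range]

/-- **Correctness of the sweeping solve** (Algorithm 2.2).  Given the
block right-hand sides `f_1, …, f_n`, the forward recursion
`v_1 = f_1`, `v_{m+1} = f_{m+1} − A_{m+1,m} (S_m⁻¹ v_m)` and the backward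
recursion `u_n = S_n⁻¹ v_n`, `u_m = S_m⁻¹ v_m − S_m⁻¹ (A_{m,m+1} u_{m+1})`
produce the solution of `A u = f`.  (Blocks are indexed by `0, …, n-1`.) -/
theorem sweeping_solve_correct
    (n k : ℕ) (hn : 1 ≤ n) (hk : 1 ≤ k)
    (A : ℕ → ℕ → Matrix (Fin k) (Fin k) ℂ)
    (htri : ∀ i j : ℕ, i < n → j < n → 1 < |(i : ℤ) - (j : ℤ)| → A i j = 0)
    (hsym : ∀ i j : ℕ, i < n → j < n → A j i = (A i j)ᵀ)
    (S : ℕ → Matrix (Fin k) (Fin k) ℂ)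
    (hS0 : S 0 = A 0 0)
    (hSrec : ∀ m : ℕ, 0 < m → m < n →
      S m = A m m - A m (m - 1) * (S (m - 1))⁻¹ * A (m - 1) m)
    (hSinv : ∀ m : ℕ, m < n → IsUnit (S m))
    (bigA : Matrix (Fin n × Fin k) (Fin n × Fin k) ℂ)
    (hbigA : bigA = Matrix.of fun p q => A p.1.val q.1.val p.2 q.2)
    (f : ℕ → Fin k → ℂ)
    (v : ℕ → Fin k → ℂ)
    (hv0 : v 0 = f 0)
    (hvrec : ∀ m : ℕ, m + 1 < n →
      v (m + 1) = f (m + 1) - (A (m + 1) m).mulVec ((S m)⁻¹.mulVec (v m)))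
    (u : ℕ → Fin k → ℂ)
    (hulast : u (n - 1) = (S (n - 1))⁻¹.mulVec (v (n - 1)))
    (hurec : ∀ m : ℕ, m + 1 < n →
      u m = (S m)⁻¹.mulVec (v m) -
        (S m)⁻¹.mulVec ((A m (m + 1)).mulVec (u (m + 1)))) :
    bigA.mulVec (fun p => u p.1.val p.2) = fun p => f p.1.val p.2 := by
  have hcan : ∀ m, m < n → ∀ x : Fin k → ℂ, (S m).mulVec ((S m)⁻¹.mulVec x) = x := by
    intro m hm x
    rw [Matrix.mulVec_mulVec, Matrix.mul_nonsing_inv _ ((Matrix.isUnit_iff_isUnit_det _).1 (hSinv m hm)),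
      Matrix.one_mulVec]
  have hU : ∀ m, m < n → (S m).mulVec (u m) +
      (if m + 1 < n then (A m (m + 1)).mulVec (u (m + 1)) else 0) = v m := by
    intro m hm
    split_ifs with h
    · rw [hurec m h, Matrix.mulVec_sub, hcan m hm, hcan m hm, sub_add_cancel]
    · have : m = n - 1 := by omega
      subst this
      rw [hulast, hcan _ hm, add_zero]
  have key : ∀ i, i < n → ∑ j ∈ Finset.range n, (A i j).mulVec (u j) = f i := by
    intro i hi
    rw [tri_sum n i hi]
    · have hUi := hU i hi
      rcases i with _ | m
      · rw [if_neg (lt_irrefl 0), zero_add, ← hv0, ← hUi, hS0]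
      · rw [if_pos (Nat.succ_pos m)]
        have hs := hSrec (m + 1) (Nat.succ_pos m) hi
        simp only [Nat.add_sub_cancel] at hs ⊢
        rw [hvrec m hi, hs, Matrix.sub_mulVec, ← Matrix.mulVec_mulVec, ← Matrix.mulVec_mulVec] at hUi
        rw [hurec m hi, Matrix.mulVec_sub]
        rw [eq_sub_iff_add_eq] at hUi
        rw [← hUi]
        abel
    · intro j hj a b c
      rw [htri i j hi hj (by rw [lt_abs]; omega), Matrix.zero_mulVec]
  funext p
  obtain ⟨i, a⟩ := p
  have h := congrFun (key i.val i.isLt) a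
  rw [hbigA]
  simp only [Matrix.mulVec, dotProduct, Matrix.of_apply, Fintype.sum_prod_type]
  rw [← h, Finset.sum_apply, Finset.sum_range]
  rfl
end
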